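/- arXiv:1707.06512 — 2 statements merged into one kernel-verified Lean document; each statement's English description precedes it below -/
import Mathlib

section
/- Every affine bijection σ of the Gram set 𝒢_N onto itself maps the set of rank-one elements of 𝒢_N (the Ising matrices) bijectively onto itself: if G ∈ 𝒢_N has rank 1 then σ(G) has rank 1. -/
open Matrix

/-- The Gram set: real symmetric positive semidefinite `N × N` matrices with unit diagonal. -/
def GramSet (N : ℕ) : Set (Matrix (Fin N) (Fin N) ℝ) :=
  {G | G.PosSemidef ∧ ∀ i, G i i = 1}

/-- `σ` is an affine bijection of the Gram set `𝒢_N` onto itself. -/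
def IsAffineBijOfGramSet (N : ℕ)
    (σ : Matrix (Fin N) (Fin N) ℝ → Matrix (Fin N) (Fin N) ℝ) : Prop :=
  Set.BijOn σ (GramSet N) (GramSet N) ∧
    ∀ G ∈ GramSet N, ∀ G' ∈ GramSet N, ∀ α : ℝ, 0 ≤ α → α ≤ 1 →
      σ (α • G + (1 - α) • G') = α • σ G + (1 - α) • σ G'

namespace Matrix.IsHermitian

variable {n : Type*} [Fintype n] [DecidableEq n] {A : Matrix n n ℝ}

lemma posSemidef_smul_one_sub (hA : A.IsHermitian) {L : ℝ} (h : ∀ i, hA.eigenvalues i ≤ L) :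
    (L • (1 : Matrix n n ℝ) - A).PosSemidef := by
  have hD : (diagonal fun i => L - hA.eigenvalues i).PosSemidef :=
    posSemidef_diagonal_iff.2 fun i => sub_nonneg.2 (h i)
  have hconj := hD.mul_mul_conjTranspose_same (hA.eigenvectorUnitary : Matrix n n ℝ)
  have hU : (hA.eigenvectorUnitary : Matrix n n ℝ) * (hA.eigenvectorUnitary : Matrix n n ℝ)ᴴ = 1 :=
    Unitary.mul_star_self_of_mem hA.eigenvectorUnitary.2
  have hspec := hA.spectral_theorem
  rw [Unitary.conjStarAlgAut_apply] at hspec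
  have hsub : (diagonal fun i => L - hA.eigenvalues i)
      = L • (1 : Matrix n n ℝ) - diagonal (RCLike.ofReal ∘ hA.eigenvalues) := by
    rw [smul_one_eq_diagonal, diagonal_sub]
    rfl
  rw [hsub, Matrix.mul_sub, Matrix.sub_mul, Matrix.mul_smul, Matrix.mul_one, Matrix.smul_mul,
    hU] at hconj
  convert hconj using 2
  exact hspec

lemma mul_eigenvalues_le_of_posSemidef (hA : A.IsHermitian) {α : ℝ}
    (h : ((1 : Matrix n n ℝ) - α • A).PosSemidef) (i : n) : α * hA.eigenvalues i ≤ 1 := by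
  have hx := h.dotProduct_mulVec_nonneg (hA.eigenvectorBasis i)
  have hne : (hA.eigenvectorBasis i : n → ℝ) ≠ 0 :=
    (WithLp.ofLp_eq_zero 2).ne.2 (hA.eigenvectorBasis.orthonormal.ne_zero i)
  have hpos := dotProduct_star_self_pos_iff.2 hne
  rw [sub_mulVec, smul_mulVec, hA.mulVec_eigenvectorBasis, one_mulVec, dotProduct_sub,
    dotProduct_smul, dotProduct_smul, dotProduct_comm] at hx
  simp only [smul_eq_mul] at hx
  rw [dotProduct_comm] at hpos
  nlinarith

end Matrix.IsHermitian

namespace GramSet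

variable {N : ℕ} {G C : Matrix (Fin N) (Fin N) ℝ}

lemma sum_eigenvalues (hG : G ∈ GramSet N) : ∑ i, hG.1.1.eigenvalues i = N := by
  have h := hG.1.1.trace_eq_sum_eigenvalues
  simpa [trace, hG.2] using h.symm

lemma eigenvalues_le (hG : G ∈ GramSet N) (i : Fin N) : hG.1.1.eigenvalues i ≤ N := by
  rw [← sum_eigenvalues hG]
  exact Finset.single_le_sum (fun j _ => hG.1.eigenvalues_nonneg j) (Finset.mem_univ i)

lemma rank_eq_one_iff (hG : G ∈ GramSet N) :
    G.rank = 1 ↔ ∃ i, hG.1.1.eigenvalues i = N := by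
  rw [hG.1.1.rank_eq_card_non_zero_eigs, Fintype.card_eq_one_iff]
  constructor
  · rintro ⟨⟨i, hi⟩, h⟩
    refine ⟨i, ?_⟩
    rw [← sum_eigenvalues hG]
    refine (Finset.sum_eq_single i (fun j _ hj => ?_) (by simp)).symm
    by_contra h0
    exact hj (congrArg Subtype.val (h ⟨j, h0⟩))
  · rintro ⟨i, hi⟩
    have hN : (N : ℝ) ≠ 0 := by
      have := i.pos
      positivity
    refine ⟨⟨i, hi ▸ hN⟩, fun ⟨j, hj⟩ => Subtype.ext ?_⟩
    by_contra hji
    have hle := Finset.sum_le_sum_of_subset_of_nonneg (Finset.subset_univ {j, i})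
      fun k _ _ => hG.1.eigenvalues_nonneg k
    rw [Finset.sum_pair hji, sum_eigenvalues hG, hi] at hle
    exact hj (le_antisymm (by linarith) (hG.1.eigenvalues_nonneg j))

lemma one_mem : (1 : Matrix (Fin N) (Fin N) ℝ) ∈ GramSet N :=
  ⟨.one, fun _ => one_apply_eq _⟩

lemma vecMulVec_mem {s : Fin N → ℝ} (hs : ∀ i, s i * s i = 1) : vecMulVec s s ∈ GramSet N :=
  ⟨by simpa using posSemidef_vecMulVec_self_star s, hs⟩

/-- If `α • G` is dominated by the identity, then the identity is a convex combination of `G` and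
another element of the Gram set, with weight `α` at `G`. -/
lemma exists_one_eq_of_posSemidef (hG : G ∈ GramSet N) {α : ℝ} (h1 : α < 1)
    (h : ((1 : Matrix (Fin N) (Fin N) ℝ) - α • G).PosSemidef) :
    ∃ H ∈ GramSet N, 1 = α • G + (1 - α) • H := by
  have hne : 1 - α ≠ 0 := by linarith
  refine ⟨(1 - α)⁻¹ • (1 - α • G), ⟨h.smul (inv_nonneg.2 (by linarith)), fun i => ?_⟩, ?_⟩
  · simp [hG.2 i, hne]
  · rw [smul_smul, mul_inv_cancel₀ hne, one_smul]
    abel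

/-- `C` is a center if every element of the Gram set is an endpoint of a segment of the Gram set
whose point of weight `1 / N` at that endpoint is `C`. -/
def IsCenter (N : ℕ) (C : Matrix (Fin N) (Fin N) ℝ) : Prop :=
  ∀ G ∈ GramSet N, ∃ H ∈ GramSet N, C = (1 / N : ℝ) • G + (1 - 1 / N : ℝ) • H

lemma isCenter_one (hN : 0 < N) : IsCenter N 1 := by
  intro G hG
  obtain rfl | hN1 : N = 1 ∨ 1 < N := by omega
  · refine ⟨1, one_mem, ?_⟩
    ext i j
    obtain rfl := Subsingleton.elim i j
    simp [hG.2 i]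
  · have hN' : (1 : ℝ) < N := by exact_mod_cast hN1
    refine exists_one_eq_of_posSemidef hG ((div_lt_one (by linarith)).2 hN') ?_
    have h := (hG.1.1.posSemidef_smul_one_sub (eigenvalues_le hG)).smul
      (show (0 : ℝ) ≤ 1 / N by positivity)
    rwa [smul_sub, smul_smul, one_div_mul_cancel (by positivity), one_smul] at h

/-- The sign vector of a Boolean vector. -/
def signVec (b : Fin N → Bool) (i : Fin N) : ℝ := if b i then 1 else -1

lemma signVec_mul_self (b : Fin N → Bool) (i : Fin N) : signVec b i * signVec b i = 1 := by
  unfold signVec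
  split_ifs <;> norm_num

lemma sum_signVec_mul {i j : Fin N} (hij : i ≠ j) :
    ∑ b : Fin N → Bool, signVec b i * signVec b j = 0 := by
  refine Finset.sum_involution (fun b _ => Function.update b i (!b i)) (fun b _ => ?_)
    (fun b _ _ h => ?_) (fun _ _ => Finset.mem_univ _) (fun b _ => by simp)
  · rcases hb : b i <;> cases hbj : b j <;> simp [signVec, hij.symm, hb, hbj]
  · simpa using congrFun h i

lemma sum_signVec_quadratic (hC : ∀ i, C i i = 1) :
    ∑ b : Fin N → Bool, signVec b ⬝ᵥ C *ᵥ signVec b = ∑ _b : Fin N → Bool, (N : ℝ) := by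
  have hexp (b : Fin N → Bool) : signVec b ⬝ᵥ C *ᵥ signVec b
      = ∑ i, ∑ j, C i j * (signVec b i * signVec b j) := by
    simp only [dotProduct, mulVec, Finset.mul_sum]
    exact Finset.sum_congr rfl fun i _ => Finset.sum_congr rfl fun j _ => by ring
  have hone (i : Fin N) : ∑ j, ∑ b : Fin N → Bool, C i j * (signVec b i * signVec b j)
      = ∑ _b : Fin N → Bool, 1 := by
    rw [Finset.sum_eq_single i]
    · simp [signVec_mul_self, hC]
    · intro j _ hj
      rw [← Finset.mul_sum, sum_signVec_mul hj.symm, mul_zero]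
    · simp
  simp only [hexp]
  rw [Finset.sum_comm]
  simp_rw [Finset.sum_comm (s := (Finset.univ : Finset (Fin N → Bool))), hone]
  simp [mul_comm]

lemma IsCenter.eq_one (hN : 0 < N) (hC : C ∈ GramSet N) (h : IsCenter N C) : C = 1 := by
  have hN0 : (0 : ℝ) < N := by exact_mod_cast hN
  have hN1 : (1 : ℝ) ≤ N := by exact_mod_cast hN
  have hpsd (b : Fin N → Bool) :
      ((N : ℝ) • C - vecMulVec (signVec b) (signVec b)).PosSemidef := by
    obtain ⟨H, hH, hCH⟩ := h _ (vecMulVec_mem (signVec_mul_self b))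
    have hs := hH.1.smul (sub_nonneg.2 hN1)
    convert hs using 1
    rw [hCH, smul_add, smul_smul, smul_smul, mul_one_div_cancel hN0.ne', one_smul, mul_sub,
      mul_one_div_cancel hN0.ne', mul_one]
    abel
  have hss (b : Fin N → Bool) : signVec b ⬝ᵥ signVec b = N := by
    simp [dotProduct, signVec_mul_self]
  have hmul (b : Fin N → Bool) :
      ((N : ℝ) • C - vecMulVec (signVec b) (signVec b)) *ᵥ signVec b
        = (N : ℝ) • (C *ᵥ signVec b - signVec b) := by
    rw [sub_mulVec, smul_mulVec, vecMulVec_mulVec, hss, smul_sub, op_smul_eq_smul]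
  have hquad (b : Fin N → Bool) :
      signVec b ⬝ᵥ ((N : ℝ) • C - vecMulVec (signVec b) (signVec b)) *ᵥ signVec b
        = N * (signVec b ⬝ᵥ C *ᵥ signVec b - N) := by
    rw [hmul, dotProduct_smul, dotProduct_sub, hss, smul_eq_mul]
  have hge (b : Fin N → Bool) : (N : ℝ) ≤ signVec b ⬝ᵥ C *ᵥ signVec b := by
    have := (hpsd b).dotProduct_mulVec_nonneg (signVec b)
    rw [star_trivial, hquad] at this
    exact sub_nonneg.1 (nonneg_of_mul_nonneg_right this hN0)
  have heq (b : Fin N → Bool) : (N : ℝ) = signVec b ⬝ᵥ C *ᵥ signVec b :=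
    (Finset.sum_eq_sum_iff_of_le fun b _ => hge b).1 (sum_signVec_quadratic hC.2).symm b
      (Finset.mem_univ b)
  have hfix (b : Fin N → Bool) : C *ᵥ signVec b = signVec b := by
    have h0 := ((hpsd b).dotProduct_mulVec_zero_iff (signVec b)).1 (by
      rw [star_trivial, hquad, ← heq, sub_self, mul_zero])
    rw [hmul] at h0
    exact sub_eq_zero.1 ((smul_eq_zero.1 h0).resolve_left hN0.ne')
  have hbasis (j : Fin N) : (2 : ℝ) • Pi.single j (1 : ℝ)
      = signVec (fun _ => true) - signVec (fun i => decide (i ≠ j)) := by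
    ext i
    by_cases hij : i = j
    · subst hij
      norm_num [signVec]
    · simp [signVec, hij]
  refine ext_of_mulVec_single fun j => ?_
  have h2 : C *ᵥ ((2 : ℝ) • Pi.single j (1 : ℝ)) = (2 : ℝ) • Pi.single j (1 : ℝ) := by
    rw [hbasis, mulVec_sub, hfix, hfix]
  rw [mulVec_smul] at h2
  rw [one_mulVec]
  exact smul_right_injective _ (two_ne_zero' ℝ) h2

lemma rank_eq_one_iff_weight_le (hN : 0 < N) (hG : G ∈ GramSet N) :
    G.rank = 1 ↔ ∀ α : ℝ, 0 ≤ α → α ≤ 1 → ∀ H ∈ GramSet N,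
      1 = α • G + (1 - α) • H → α ≤ 1 / N := by
  have hN0 : (0 : ℝ) < N := by exact_mod_cast hN
  rw [rank_eq_one_iff hG]
  constructor
  · rintro ⟨i, hi⟩ α h0 h1 H hH hGH
    have hpsd : ((1 : Matrix (Fin N) (Fin N) ℝ) - α • G).PosSemidef := by
      rw [hGH, add_sub_cancel_left]
      exact hH.1.smul (sub_nonneg.2 h1)
    have := hG.1.1.mul_eigenvalues_le_of_posSemidef hpsd i
    rwa [hi, ← le_div_iff₀ hN0] at this
  · intro h
    have : Nonempty (Fin N) := ⟨⟨0, hN⟩⟩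
    obtain ⟨i, hi⟩ := Finite.exists_max hG.1.1.eigenvalues
    by_contra! hne
    have hlt : hG.1.1.eigenvalues i < N := lt_of_le_of_ne (eigenvalues_le hG i) (hne i)
    have hN1 : (1 : ℝ) < N := by
      by_contra! hle
      obtain rfl : N = 1 := le_antisymm (by exact_mod_cast hle) hN
      refine hne i ?_
      rw [← sum_eigenvalues hG, Fintype.sum_subsingleton _ i]
    obtain ⟨L, hL, hLN⟩ := exists_between (max_lt hlt hN1)
    have hL1 : 1 < L := (le_max_right _ _).trans_lt hL
    have hL0 : 0 < L := by linarith
    have hα : L⁻¹ < 1 := inv_lt_one_of_one_lt₀ hL1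
    have hpsd := (hG.1.1.posSemidef_smul_one_sub
      fun j => (hi j).trans ((le_max_left _ _).trans hL.le)).smul (inv_nonneg.2 hL0.le)
    rw [smul_sub, smul_smul, inv_mul_cancel₀ hL0.ne', one_smul] at hpsd
    obtain ⟨H, hH, hGH⟩ := exists_one_eq_of_posSemidef hG hα hpsd
    have hle := h _ (inv_nonneg.2 hL0.le) hα.le H hH hGH
    rw [one_div, inv_le_inv₀ hL0 hN0] at hle
    exact hle.not_gt hLN

end GramSet

namespace IsAffineBijOfGramSet

variable {N : ℕ} {σ : Matrix (Fin N) (Fin N) ℝ → Matrix (Fin N) (Fin N) ℝ}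

lemma map_one (hσ : IsAffineBijOfGramSet N σ) (hN : 0 < N) : σ 1 = 1 := by
  refine GramSet.IsCenter.eq_one hN (hσ.1.mapsTo GramSet.one_mem) fun G' hG' => ?_
  obtain ⟨G, hG, rfl⟩ := hσ.1.surjOn hG'
  obtain ⟨H, hH, hGH⟩ := GramSet.isCenter_one hN G hG
  refine ⟨σ H, hσ.1.mapsTo hH, ?_⟩
  have hN1 : (1 : ℝ) ≤ N := by exact_mod_cast hN
  rw [← hσ.2 G hG H hH _ (by positivity) ((div_le_one (by linarith)).2 hN1), ← hGH]

lemma convexCombination_mem {G H : Matrix (Fin N) (Fin N) ℝ} (hG : G ∈ GramSet N)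
    (hH : H ∈ GramSet N) {α : ℝ} (h0 : 0 ≤ α) (h1 : α ≤ 1) :
    α • G + (1 - α) • H ∈ GramSet N :=
  ⟨(hG.1.smul h0).add (hH.1.smul (sub_nonneg.2 h1)), fun i => by simp [hG.2 i, hH.2 i]⟩

lemma rank_map_eq_one_iff (hσ : IsAffineBijOfGramSet N σ) (hN : 0 < N)
    {G : Matrix (Fin N) (Fin N) ℝ} (hG : G ∈ GramSet N) : (σ G).rank = 1 ↔ G.rank = 1 := by
  rw [GramSet.rank_eq_one_iff_weight_le hN hG,
    GramSet.rank_eq_one_iff_weight_le hN (hσ.1.mapsTo hG)]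
  constructor
  · intro h α h0 h1 H hH hGH
    refine h α h0 h1 (σ H) (hσ.1.mapsTo hH) ?_
    rw [← hσ.2 G hG H hH α h0 h1, ← hGH, hσ.map_one hN]
  · intro h α h0 h1 H' hH' hGH
    obtain ⟨H, hH, rfl⟩ := hσ.1.surjOn hH'
    refine h α h0 h1 H hH (hσ.1.injOn GramSet.one_mem (convexCombination_mem hG hH h0 h1) ?_)
    rw [hσ.map_one hN, hσ.2 G hG H hH α h0 h1, hGH]

end IsAffineBijOfGramSet

/-- Every affine bijection of the Gram set maps the set of its rank-one elements
(the Ising matrices) bijectively onto itself. -/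
theorem affineBij_bijOn_ising (N : ℕ)
    (σ : Matrix (Fin N) (Fin N) ℝ → Matrix (Fin N) (Fin N) ℝ)
    (hσ : IsAffineBijOfGramSet N σ) :
    Set.BijOn σ {G | G ∈ GramSet N ∧ G.rank = 1} {G | G ∈ GramSet N ∧ G.rank = 1} := by
  obtain rfl | hN := N.eq_zero_or_pos
  · have hempty : {G : Matrix (Fin 0) (Fin 0) ℝ | G ∈ GramSet 0 ∧ G.rank = 1} = ∅ := by
      refine Set.eq_empty_iff_forall_notMem.2 fun G hG => ?_
      have hle := G.rank_le_width
      have hrank := hG.2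
      omega
    rw [hempty]
    exact Set.bijOn_empty σ
  · refine ⟨fun G hG => ⟨hσ.1.mapsTo hG.1, (hσ.rank_map_eq_one_iff hN hG.1).2 hG.2⟩,
      hσ.1.injOn.mono fun G hG => hG.1, fun G' hG' => ?_⟩
    obtain ⟨G, hG, rfl⟩ := hσ.1.surjOn hG'.1
    exact ⟨G, ⟨hG, (hσ.rank_map_eq_one_iff hN hG).1 hG'.2⟩, rfl⟩
end

section
/- If two affine bijections σ, τ of the Gram set 𝒢_N onto itself satisfy σ(γ) = τ(γ) for every Ising matrix γ = v vᵀ (v ∈ {−1,1}^N), then σ = τ on all of 𝒢_N. In particular, an affine bijection of 𝒢_N fixing every Ising matrix is the identity, and the group of affine bijections of 𝒢_N is finite. -/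
open Matrix

/-- The real sign vector of a family of integer units. -/
def signVec {N : ℕ} (ε : Fin N → ℤˣ) : Fin N → ℝ := fun i => ((ε i : ℤ) : ℝ)

/-- The set of Ising matrices. -/
def isingSet (N : ℕ) : Set (Matrix (Fin N) (Fin N) ℝ) :=
  Set.range fun ε : Fin N → ℤˣ => vecMulVec (signVec ε) (signVec ε)

lemma signVec_eq_or {N : ℕ} (ε : Fin N → ℤˣ) (i : Fin N) :
    signVec ε i = 1 ∨ signVec ε i = -1 := by
  rcases Int.units_eq_one_or (ε i) with h | h <;> simp [signVec, h]

lemma signVec_mul_self {N : ℕ} (ε : Fin N → ℤˣ) (i : Fin N) :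
    signVec ε i * signVec ε i = 1 := by
  rcases signVec_eq_or ε i with h | h <;> simp [h]

lemma exists_signVec_eq {N : ℕ} {v : Fin N → ℝ} (hv : ∀ i, v i = 1 ∨ v i = -1) :
    ∃ ε, signVec ε = v := by
  have h : ∀ i, ∃ u : ℤˣ, ((u : ℤ) : ℝ) = v i := fun i => by
    rcases hv i with h | h
    · exact ⟨1, by simp [h]⟩
    · exact ⟨-1, by simp [h]⟩
  choose ε hε using h
  exact ⟨ε, funext hε⟩

lemma vecMulVec_mem_gramSet {N : ℕ} (ε : Fin N → ℤˣ) :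
    vecMulVec (signVec ε) (signVec ε) ∈ GramSet N := by
  refine ⟨?_, fun i => by simp [vecMulVec_apply, signVec_mul_self]⟩
  simpa using posSemidef_vecMulVec_self_star (signVec ε)

lemma convex_gramSet (N : ℕ) : Convex ℝ (GramSet N) := by
  intro G hG H hH a b ha hb hab
  exact ⟨(hG.1.smul ha).add (hH.1.smul hb), fun i => by simp [hG.2, hH.2, hab]⟩

lemma gramSet_symm {N : ℕ} {G : Matrix (Fin N) (Fin N) ℝ} (hG : G ∈ GramSet N) (i j : Fin N) :
    G i j = G j i := by
  simpa using (hG.1.1.apply i j).symm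

section Moments

variable {N : ℕ}

/-- Averaging over signs kills every function that is odd under flipping one coordinate. -/
lemma sum_signs_eq_zero (m : Fin N) (f : (Fin N → ℝ) → ℝ)
    (hf : ∀ v : Fin N → ℝ, f (Function.update v m (-v m)) = -f v) :
    ∑ ε : Fin N → ℤˣ, f (signVec ε) = 0 := by
  have h := Equiv.sum_comp (Equiv.mulRight (Function.update (1 : Fin N → ℤˣ) m (-1)))
    (fun ε => f (signVec ε))
  have h2 : ∀ ε : Fin N → ℤˣ,
      signVec (Equiv.mulRight (Function.update (1 : Fin N → ℤˣ) m (-1)) ε) =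
        Function.update (signVec ε) m (-signVec ε m) := by
    intro ε
    funext i
    by_cases hi : i = m
    · subst hi; simp [signVec]
    · simp [signVec, hi]
  simp only [h2, hf, Finset.sum_neg_distrib] at h
  linarith

lemma sum_signs_one : ∑ _ε : Fin N → ℤˣ, (1 : ℝ) = 2 ^ N := by
  simp

lemma sum_signs_two (k l : Fin N) :
    ∑ ε : Fin N → ℤˣ, signVec ε k * signVec ε l = if k = l then 2 ^ N else 0 := by
  split_ifs with h
  · subst h
    simp only [signVec_mul_self, sum_signs_one]
  · exact sum_signs_eq_zero k (fun v => v k * v l) fun v => by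
      simp [Function.update_of_ne (Ne.symm h)]

lemma sum_signs_four {k l : Fin N} (hkl : k ≠ l) (i j : Fin N) :
    ∑ ε : Fin N → ℤˣ, signVec ε i * signVec ε j * (signVec ε k * signVec ε l) =
      2 ^ N * ((if i = k ∧ j = l then 1 else 0) + (if i = l ∧ j = k then 1 else 0)) := by
  by_cases h1 : i = k ∧ j = l
  · obtain ⟨rfl, rfl⟩ := h1
    have : ∀ ε : Fin N → ℤˣ,
        signVec ε i * signVec ε j * (signVec ε i * signVec ε j) = 1 := fun ε => by
      linear_combination signVec ε j * signVec ε j * signVec_mul_self ε i + signVec_mul_self ε j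
    simp only [this, sum_signs_one]
    simp [hkl]
  by_cases h2 : i = l ∧ j = k
  · obtain ⟨rfl, rfl⟩ := h2
    have : ∀ ε : Fin N → ℤˣ,
        signVec ε i * signVec ε j * (signVec ε j * signVec ε i) = 1 := fun ε => by
      linear_combination signVec ε j * signVec ε j * signVec_mul_self ε i + signVec_mul_self ε j
    simp only [this, sum_signs_one]
    simp [hkl.symm]
  rw [if_neg h1, if_neg h2, add_zero, mul_zero]
  have odd_l : (i = l ↔ j = l) → ∑ ε : Fin N → ℤˣ,
      signVec ε i * signVec ε j * (signVec ε k * signVec ε l) = 0 := fun h =>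
    sum_signs_eq_zero l (fun v => v i * v j * (v k * v l)) fun v => by
      by_cases hj : j = l
      · simp [h.2 hj, hj, hkl]
      · simp [mt h.1 hj, hj, hkl]
  have odd_k : (i = k ↔ j = k) → ∑ ε : Fin N → ℤˣ,
      signVec ε i * signVec ε j * (signVec ε k * signVec ε l) = 0 := fun h =>
    sum_signs_eq_zero k (fun v => v i * v j * (v k * v l)) fun v => by
      by_cases hj : j = k
      · simp [h.2 hj, hj, hkl.symm]
      · simp [mt h.1 hj, hj, hkl.symm]
  by_cases hl : i = l ↔ j = l
  · exact odd_l hl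
  · apply odd_k
    grind

end Moments

/-- The quadratic form of a matrix at a vector, as a linear functional of the matrix. -/
def quadFormAt {N : ℕ} (v : Fin N → ℝ) : Matrix (Fin N) (Fin N) ℝ →ₗ[ℝ] ℝ where
  toFun X := ∑ i, ∑ j, X i j * (v i * v j)
  map_add' X Y := by simp [add_mul, Finset.sum_add_distrib]
  map_smul' c X := by simp [Finset.mul_sum, mul_assoc]

lemma quadFormAt_apply {N : ℕ} (v : Fin N → ℝ) (X : Matrix (Fin N) (Fin N) ℝ) :
    quadFormAt v X = ∑ i, ∑ j, X i j * (v i * v j) := rfl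

lemma quadFormAt_nonneg {N : ℕ} {G : Matrix (Fin N) (Fin N) ℝ} (hG : G.PosSemidef)
    (v : Fin N → ℝ) : 0 ≤ quadFormAt v G := by
  have h := hG.dotProduct_mulVec_nonneg v
  have h2 : star v ⬝ᵥ G *ᵥ v = quadFormAt v G := by
    simp only [quadFormAt_apply, dotProduct, mulVec, Finset.mul_sum]
    refine Finset.sum_congr rfl fun i _ => Finset.sum_congr rfl fun j _ => ?_
    simp
    ring
  rwa [h2] at h

/-- The coefficient of the Ising matrix of `v` in the expansion of `(1 - t) • 1 + t • G`. -/
noncomputable def isingWeight {N : ℕ} (G : Matrix (Fin N) (Fin N) ℝ) (t : ℝ) (v : Fin N → ℝ) : ℝ :=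
  (2 ^ N)⁻¹ * (1 + t * ((quadFormAt v G - N) / 2))

section Expansion

variable {N : ℕ} {G : Matrix (Fin N) (Fin N) ℝ}

lemma sum_quadFormAt_mul (f : (Fin N → ℝ) → ℝ) :
    ∑ ε : Fin N → ℤˣ, quadFormAt (signVec ε) G * f (signVec ε) =
      ∑ i, ∑ j, G i j *
        ∑ ε : Fin N → ℤˣ, signVec ε i * signVec ε j * f (signVec ε) := by
  simp only [quadFormAt_apply, Finset.sum_mul, Finset.mul_sum]
  rw [Finset.sum_comm]
  refine Finset.sum_congr rfl fun i _ => ?_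
  rw [Finset.sum_comm]
  refine Finset.sum_congr rfl fun j _ => Finset.sum_congr rfl fun ε _ => ?_
  ring

lemma sum_quadFormAt (hG : G ∈ GramSet N) :
    ∑ ε : Fin N → ℤˣ, quadFormAt (signVec ε) G = 2 ^ N * N := by
  have h := sum_quadFormAt_mul (G := G) (fun _ => 1)
  simp only [mul_one, sum_signs_two] at h
  rw [h]
  simp [hG.2, mul_comm]

lemma sum_quadFormAt_mul_mul (hG : G ∈ GramSet N) {k l : Fin N} (hkl : k ≠ l) :
    ∑ ε : Fin N → ℤˣ, quadFormAt (signVec ε) G * (signVec ε k * signVec ε l) =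
      2 ^ N * (2 * G k l) := by
  have h := sum_quadFormAt_mul (G := G) (fun v => v k * v l)
  simp only [sum_signs_four hkl] at h
  rw [h]
  have e : ∀ i j : Fin N, G i j * (2 ^ N * ((if i = k ∧ j = l then 1 else 0) +
      (if i = l ∧ j = k then 1 else 0))) =
      (if i = k then (if j = l then 2 ^ N * G i j else 0) else 0) +
      (if i = l then (if j = k then 2 ^ N * G i j else 0) else 0) := by
    intro i j
    split_ifs <;> grind
  simp only [e, Finset.sum_add_distrib]
  simp [gramSet_symm hG l k]
  ring

lemma sum_isingWeight (hG : G ∈ GramSet N) (t : ℝ) :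
    ∑ ε : Fin N → ℤˣ, isingWeight G t (signVec ε) = 1 := by
  have h := sum_quadFormAt hG
  have h1 := sum_signs_one (N := N)
  simp only [isingWeight, ← Finset.mul_sum, Finset.sum_add_distrib, ← Finset.sum_div,
    Finset.sum_sub_distrib, h, h1]
  simp

lemma sum_isingWeight_smul (hG : G ∈ GramSet N) (t : ℝ) :
    ∑ ε : Fin N → ℤˣ, isingWeight G t (signVec ε) • vecMulVec (signVec ε) (signVec ε) =
      t • G + (1 - t) • (1 : Matrix (Fin N) (Fin N) ℝ) := by
  ext k l
  simp only [Matrix.sum_apply, Matrix.smul_apply, vecMulVec_apply, smul_eq_mul, Matrix.add_apply]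
  by_cases hkl : k = l
  · subst hkl
    simp [signVec_mul_self, sum_isingWeight hG, hG.2]
  · have h := sum_quadFormAt_mul_mul hG hkl
    have h2 := sum_signs_two k l
    rw [if_neg hkl] at h2
    have e : ∀ ε : Fin N → ℤˣ, isingWeight G t (signVec ε) * (signVec ε k * signVec ε l) =
        (2 ^ N)⁻¹ * (1 - t * N / 2) * (signVec ε k * signVec ε l) +
        (2 ^ N)⁻¹ * (t / 2) * (quadFormAt (signVec ε) G * (signVec ε k * signVec ε l)) := by
      intro ε
      simp only [isingWeight]
      ring
    simp only [e, Finset.sum_add_distrib, ← Finset.mul_sum, h, h2, Matrix.one_apply_ne hkl]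
    field_simp
    ring

lemma isingWeight_nonneg (hG : G ∈ GramSet N) {t : ℝ} (ht : 0 ≤ t) (htN : t * N ≤ 1)
    (v : Fin N → ℝ) : 0 ≤ isingWeight G t v := by
  have h := mul_nonneg ht (quadFormAt_nonneg hG.1 v)
  have h2 : 0 ≤ 1 + t * ((quadFormAt v G - N) / 2) := by nlinarith
  exact mul_nonneg (by positivity) h2

end Expansion

section Affine

variable {N : ℕ} {σ : Matrix (Fin N) (Fin N) ℝ → Matrix (Fin N) (Fin N) ℝ}

lemma IsAffineBijOfGramSet.map_sum (hσ : IsAffineBijOfGramSet N σ) {ι : Type*} (s : Finset ι)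
    (w : ι → ℝ) (p : ι → Matrix (Fin N) (Fin N) ℝ) (hw : ∀ i ∈ s, 0 ≤ w i)
    (hw1 : ∑ i ∈ s, w i = 1) (hp : ∀ i ∈ s, p i ∈ GramSet N) :
    σ (∑ i ∈ s, w i • p i) = ∑ i ∈ s, w i • σ (p i) := by
  have key : ∀ k l, ∀ x ∈ GramSet N, ∀ y ∈ GramSet N, ∀ a b : ℝ, 0 ≤ a → 0 ≤ b → a + b = 1 →
      σ (a • x + b • y) k l = a • σ x k l + b • σ y k l := by
    intro k l x hx y hy a b ha hb hab
    obtain rfl : b = 1 - a := by linarith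
    rw [hσ.2 x hx y hy a ha (by linarith)]
    simp
  ext k l
  have hcvx : ConvexOn ℝ (GramSet N) (fun X => σ X k l) :=
    ⟨convex_gramSet N, fun x hx y hy a b ha hb hab => (key k l x hx y hy a b ha hb hab).le⟩
  have hccv : ConcaveOn ℝ (GramSet N) (fun X => σ X k l) :=
    ⟨convex_gramSet N, fun x hx y hy a b ha hb hab => (key k l x hx y hy a b ha hb hab).ge⟩
  simpa [Matrix.sum_apply] using
    le_antisymm (hcvx.map_sum_le hw hw1 hp) (hccv.le_map_sum hw hw1 hp)

lemma IsAffineBijOfGramSet.eq_sum (hσ : IsAffineBijOfGramSet N σ)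
    {G : Matrix (Fin N) (Fin N) ℝ} (hG : G ∈ GramSet N) :
    σ G = ∑ ε : Fin N → ℤˣ,
      isingWeight G 1 (signVec ε) • σ (vecMulVec (signVec ε) (signVec ε)) := by
  have h : ∀ t : ℝ, 0 ≤ t → t * N ≤ 1 → σ (t • G + (1 - t) • 1) = ∑ ε : Fin N → ℤˣ,
      isingWeight G t (signVec ε) • σ (vecMulVec (signVec ε) (signVec ε)) := fun t ht htN => by
    rw [← sum_isingWeight_smul hG]
    exact hσ.map_sum _ _ _ (fun ε _ => isingWeight_nonneg hG ht htN _) (sum_isingWeight hG t)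
      fun ε _ => vecMulVec_mem_gramSet ε
  have h1 : (1 : Matrix (Fin N) (Fin N) ℝ) ∈ GramSet N := ⟨PosSemidef.one, fun i => by simp⟩
  have h0 := h 0 le_rfl (by simp)
  simp only [zero_smul, sub_zero, one_smul, zero_add] at h0
  have hN : (0 : ℝ) < N + 1 := by positivity
  obtain ⟨t, ht⟩ : ∃ t : ℝ, t = ((N : ℝ) + 1)⁻¹ := ⟨_, rfl⟩
  have ht0 : 0 < t := by rw [ht]; positivity
  have htN : t * N + t = 1 := by rw [ht]; field_simp
  have hNt : 0 ≤ t * N := by positivity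
  have h2 := h t ht0.le (by linarith)
  rw [hσ.2 G hG 1 h1 t ht0.le (by linarith), h0] at h2
  have h3 : ∀ ε : Fin N → ℤˣ, isingWeight G t (signVec ε) =
      t * isingWeight G 1 (signVec ε) + (1 - t) * isingWeight G 0 (signVec ε) := fun ε => by
    simp only [isingWeight]
    ring
  simp only [h3, add_smul, mul_smul, Finset.sum_add_distrib, ← Finset.smul_sum] at h2
  exact smul_right_injective _ ht0.ne' (add_right_cancel h2)

lemma IsAffineBijOfGramSet.exists_linear (hσ : IsAffineBijOfGramSet N σ) :
    ∃ (L : Matrix (Fin N) (Fin N) ℝ →ₗ[ℝ] Matrix (Fin N) (Fin N) ℝ)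
      (a : Matrix (Fin N) (Fin N) ℝ), ∀ G ∈ GramSet N, σ G = a + L G := by
  refine ⟨∑ ε : Fin N → ℤˣ, ((2 ^ N)⁻¹ * 2⁻¹ : ℝ) •
      (quadFormAt (signVec ε)).smulRight (σ (vecMulVec (signVec ε) (signVec ε))),
    ∑ ε : Fin N → ℤˣ, ((2 ^ N)⁻¹ * (1 - N / 2) : ℝ) •
      σ (vecMulVec (signVec ε) (signVec ε)), fun G hG => ?_⟩
  rw [hσ.eq_sum hG, LinearMap.sum_apply, ← Finset.sum_add_distrib]
  refine Finset.sum_congr rfl fun ε _ => ?_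
  rw [LinearMap.smul_apply, LinearMap.smulRight_apply, smul_smul, ← add_smul, isingWeight]
  congr 1
  ring

lemma IsAffineBijOfGramSet.eq_of_eqOn_ising {τ : Matrix (Fin N) (Fin N) ℝ →
    Matrix (Fin N) (Fin N) ℝ} (hσ : IsAffineBijOfGramSet N σ) (hτ : IsAffineBijOfGramSet N τ)
    (h : Set.EqOn σ τ (isingSet N)) : Set.EqOn σ τ (GramSet N) := fun G hG => by
  rw [hσ.eq_sum hG, hτ.eq_sum hG]
  exact Finset.sum_congr rfl fun ε _ => by rw [h ⟨ε, rfl⟩]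

end Affine

/-- `G` lies on an ellipse contained in the Gram set, with nonzero tangent direction at `G`. -/
def OnEllipse {N : ℕ} (G : Matrix (Fin N) (Fin N) ℝ) : Prop :=
  ∃ C A B : Matrix (Fin N) (Fin N) ℝ, C + A = G ∧ B ≠ 0 ∧
    ∀ c s : ℝ, c ^ 2 + s ^ 2 = 1 → C + c • A + s • B ∈ GramSet N

section Ellipse

variable {N : ℕ} {G : Matrix (Fin N) (Fin N) ℝ}

lemma dotProduct_single_comb (hG : G ∈ GramSet N) (i j : Fin N) (a b : ℝ) :
    (a • Pi.single i 1 + b • Pi.single j 1) ⬝ᵥ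
      G *ᵥ (a • Pi.single i 1 + b • Pi.single j 1) = a ^ 2 + b ^ 2 + 2 * a * b * G i j := by
  simp [mulVec_add, mulVec_smul, hG.2, gramSet_symm hG j i]
  ring

lemma abs_apply_le_one (hG : G ∈ GramSet N) (i j : Fin N) : |G i j| ≤ 1 := by
  have h : ∀ a b : ℝ, 0 ≤ a ^ 2 + b ^ 2 + 2 * a * b * G i j := fun a b => by
    rw [← dotProduct_single_comb hG]
    exact hG.1.dotProduct_mulVec_nonneg (a • Pi.single i 1 + b • Pi.single j 1)
  have h1 := h 1 1
  have h2 := h 1 (-1)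
  rw [abs_le]
  constructor <;> linarith

lemma not_onEllipse_of_mem_isingSet (hG : G ∈ isingSet N) : ¬ OnEllipse G := by
  rintro ⟨C, A, B, hCA, hB, h⟩
  obtain ⟨ε, rfl⟩ := hG
  apply hB
  ext i j
  have hCAij : C i j + A i j = signVec ε i * signVec ε j := congrFun (congrFun hCA i) j
  have hs : (signVec ε i * signVec ε j) * (signVec ε i * signVec ε j) = 1 := by
    linear_combination
      signVec ε j * signVec ε j * signVec_mul_self ε i + signVec_mul_self ε j
  set p := signVec ε i * signVec ε j
  have bound : ∀ t : ℝ, t * (p * B i j) ≤ t ^ 2 * (p * A i j) := by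
    intro t
    have ht : (0 : ℝ) < 1 + t ^ 2 := by positivity
    have hm := h ((1 - t ^ 2) / (1 + t ^ 2)) (2 * t / (1 + t ^ 2)) (by field_simp; ring)
    have h1 := abs_apply_le_one hm i j
    have h2 : p * ((C + ((1 - t ^ 2) / (1 + t ^ 2)) • A + (2 * t / (1 + t ^ 2)) • B) i j) ≤ 1 := by
      have hp : |p| = 1 := by
        rcases mul_self_eq_one_iff.1 hs with hp | hp <;> simp [hp]
      refine (le_abs_self _).trans ?_
      rwa [abs_mul, hp, one_mul]
    have h3 : p * ((C + ((1 - t ^ 2) / (1 + t ^ 2)) • A + (2 * t / (1 + t ^ 2)) • B) i j) =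
        1 + 2 * (t * (p * B i j) - t ^ 2 * (p * A i j)) / (1 + t ^ 2) := by
      simp only [Matrix.add_apply, Matrix.smul_apply, smul_eq_mul]
      field_simp
      linear_combination (1 + t ^ 2) * p * hCAij + (1 + t ^ 2) * hs
    rw [h3] at h2
    have h4 : 2 * (t * (p * B i j) - t ^ 2 * (p * A i j)) / (1 + t ^ 2) ≤ 0 := by linarith
    rw [div_le_iff₀ ht] at h4
    linarith
  have hpB : p * B i j = 0 := by
    have hpos : 0 < |p * A i j| + 1 := by positivity
    have h1 := bound (p * B i j / (|p * A i j| + 1))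
    rw [div_pow, div_mul_eq_mul_div, div_mul_eq_mul_div, div_le_div_iff₀ hpos (by positivity)] at h1
    have h2 : p * B i j * (p * B i j) * (|p * A i j| + 1) ≤ (p * B i j) ^ 2 * (p * A i j) := by
      nlinarith
    have h3 := le_abs_self (p * A i j)
    have h4 := sq_nonneg (p * B i j)
    have : (p * B i j) ^ 2 = 0 := by nlinarith
    exact pow_eq_zero_iff two_ne_zero |>.1 this
  have hB2 : p * (p * B i j) = B i j := by rw [← mul_assoc, hs, one_mul]
  rw [← hB2, hpB, mul_zero, Matrix.zero_apply]

lemma mem_isingSet_of_abs_eq_one (hG : G ∈ GramSet N) (h : ∀ i j, |G i j| = 1) :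
    G ∈ isingSet N := by
  rcases isEmpty_or_nonempty (Fin N) with _ | ⟨⟨o⟩⟩
  · exact ⟨fun _ => 1, Subsingleton.elim _ _⟩
  obtain ⟨ε, hε⟩ := exists_signVec_eq (v := G o) fun i => eq_or_eq_neg_of_abs_eq (h o i)
  refine ⟨ε, ?_⟩
  ext i j
  have hsq : G o i * G o i = 1 := by rw [← hε, signVec_mul_self]
  have h0 := dotProduct_single_comb hG o i (-G o i) 1
  have h1 : G *ᵥ (-G o i • Pi.single o 1 + (1 : ℝ) • Pi.single i 1) = 0 := by
    rw [← hG.1.dotProduct_mulVec_zero_iff, star_trivial, h0]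
    linear_combination -hsq
  have h2 := congrFun h1 j
  simp [mulVec_add, mulVec_smul, -neg_smul] at h2
  change vecMulVec (signVec ε) (signVec ε) i j = G i j
  rw [hε, vecMulVec_apply]
  rw [gramSet_symm hG j i, gramSet_symm hG j o] at h2
  linarith

/-- Rotating the `k`-th Gram vector of `G` along the unit tangent vector `w`. -/
lemma rotate_mem_gramSet (hG : G ∈ GramSet N) (k : Fin N) (w : Fin N → ℝ)
    (hw : (G *ᵥ w) k = 0) (hww : w ⬝ᵥ G *ᵥ w = 1) {c s : ℝ} (hcs : c ^ 2 + s ^ 2 = 1) :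
    (G - (vecMulVec (Pi.single k 1) (G k - Pi.single k 1) +
        vecMulVec (G k - Pi.single k 1) (Pi.single k 1))) +
      c • (vecMulVec (Pi.single k 1) (G k - Pi.single k 1) +
        vecMulVec (G k - Pi.single k 1) (Pi.single k 1)) +
      s • (vecMulVec (Pi.single k 1) (G *ᵥ w) + vecMulVec (G *ᵥ w) (Pi.single k 1))
      ∈ GramSet N := by
  refine ⟨?_, fun i => ?_⟩
  · set u : Fin N → ℝ := (c - 1) • Pi.single k 1 + s • w with hu
    set M : Matrix (Fin N) (Fin N) ℝ := 1 + vecMulVec u (Pi.single k 1) with hM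
    have hsymm : Gᵀ = G := by ext i j; exact gramSet_symm hG j i
    have hGu : G *ᵥ u = (c - 1) • G k + s • (G *ᵥ w) := by
      rw [hu, mulVec_add, mulVec_smul, mulVec_smul]
      congr 2
      ext i
      simpa using gramSet_symm hG i k
    have huG : u ᵥ* G = G *ᵥ u := by rw [← mulVec_transpose, hsymm]
    have hwk : w ⬝ᵥ G k = 0 := by rw [dotProduct_comm]; exact hw
    have huu : u ⬝ᵥ G *ᵥ u = 2 - 2 * c := by
      rw [hGu, hu]
      simp [hw, hww, hwk, hG.2]
      linear_combination hcs
    have key : Mᴴ * G * M = G + vecMulVec (Pi.single k 1) (G *ᵥ u) +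
        vecMulVec (G *ᵥ u) (Pi.single k 1) +
        (2 - 2 * c) • vecMulVec (Pi.single k 1) (Pi.single k 1) := by
      rw [hM, conjTranspose_eq_transpose_of_trivial, transpose_add, transpose_one,
        transpose_vecMulVec, add_mul, one_mul, mul_add, mul_one, add_mul, vecMulVec_mul, mul_vecMulVec,
        vecMulVec_mul_vecMulVec, huG, dotProduct_comm, huu, vecMulVec_smul]
      abel
    have := hG.1.conjTranspose_mul_mul_same M
    rw [key] at this
    convert this using 1
    ext i j
    simp only [hGu, Matrix.add_apply, Matrix.sub_apply, Matrix.smul_apply, vecMulVec_apply,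
      Pi.sub_apply, Pi.add_apply, Pi.smul_apply, smul_eq_mul]
    ring
  · by_cases hik : i = k
    · subst hik
      simp [vecMulVec_apply, hG.2, hw]
    · simp [vecMulVec_apply, hG.2, hik]

lemma onEllipse_of_notMem_isingSet (hG : G ∈ GramSet N) (h : G ∉ isingSet N) : OnEllipse G := by
  obtain ⟨k, j, hkj⟩ : ∃ k j, |G k j| ≠ 1 := by
    by_contra! hall
    exact h (mem_isingSet_of_abs_eq_one hG hall)
  have hlt : |G k j| < 1 := lt_of_le_of_ne (abs_apply_le_one hG k j) hkj
  have hg : 0 < 1 - G k j ^ 2 := by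
    have := (sq_lt_one_iff_abs_lt_one (G k j)).2 hlt
    linarith
  have hne : j ≠ k := by
    rintro rfl
    simp [hG.2] at hlt
  set r := √(1 - G k j ^ 2) with hr
  have hr0 : 0 < r := Real.sqrt_pos.2 hg
  have hr2 : r ^ 2 = 1 - G k j ^ 2 := Real.sq_sqrt hg.le
  set w : Fin N → ℝ := (-(G k j) / r) • Pi.single k 1 + (1 / r) • Pi.single j 1 with hw
  have hGw : ∀ i, (G *ᵥ w) i = -(G k j) / r * G i k + 1 / r * G i j := fun i => by
    simp [hw, mulVec_add, mulVec_smul]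
  have hwk : (G *ᵥ w) k = 0 := by
    rw [hGw, hG.2]
    ring
  have hww : w ⬝ᵥ G *ᵥ w = 1 := by
    rw [hw, dotProduct_single_comb hG]
    field_simp
    linear_combination -hr2
  refine ⟨_, _, _, sub_add_cancel _ _, ?_, fun c s hcs => rotate_mem_gramSet hG k w hwk hww hcs⟩
  intro h0
  have h1 := congrFun (congrFun h0 k) j
  have h2 : (G *ᵥ w) j = r := by
    rw [hGw, hG.2, gramSet_symm hG j k]
    field_simp
    linear_combination -hr2
  simp [vecMulVec_apply, hne, h2] at h1
  exact hr0.ne' h1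

lemma IsAffineBijOfGramSet.onEllipse {σ : Matrix (Fin N) (Fin N) ℝ → Matrix (Fin N) (Fin N) ℝ}
    (hσ : IsAffineBijOfGramSet N σ) (hG : G ∈ GramSet N) (h : OnEllipse G) :
    OnEllipse (σ G) := by
  obtain ⟨L, a, hL⟩ := hσ.exists_linear
  obtain ⟨C, A, B, rfl, hB, hmem⟩ := h
  have himage : ∀ c s : ℝ, c ^ 2 + s ^ 2 = 1 →
      σ (C + c • A + s • B) = a + L C + c • L A + s • L B := fun c s hcs => by
    rw [hL _ (hmem c s hcs)]
    simp [add_assoc]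
  refine ⟨a + L C, L A, L B, ?_, ?_, fun c s hcs => ?_⟩
  · rw [hL _ hG, map_add, add_assoc]
  · intro hLB
    have e1 := himage 0 1 (by norm_num)
    have e2 := himage 0 (-1) (by norm_num)
    rw [hLB, smul_zero] at e1 e2
    have h3 := hσ.1.injOn (hmem 0 1 (by norm_num)) (hmem 0 (-1) (by norm_num)) (e1.trans e2.symm)
    have h4 : (1 : ℝ) • B = (-1 : ℝ) • B := add_left_cancel h3
    rw [← sub_eq_zero, ← sub_smul] at h4
    exact hB ((smul_eq_zero.1 h4).resolve_left (by norm_num))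
  · rw [← himage c s hcs]
    exact hσ.1.mapsTo (hmem c s hcs)

end Ellipse

lemma isingSet_subset_gramSet (N : ℕ) : isingSet N ⊆ GramSet N := by
  rintro _ ⟨ε, rfl⟩
  exact vecMulVec_mem_gramSet ε

lemma finite_isingSet (N : ℕ) : (isingSet N).Finite := Set.finite_range _

lemma IsAffineBijOfGramSet.image_isingSet {N : ℕ}
    {σ : Matrix (Fin N) (Fin N) ℝ → Matrix (Fin N) (Fin N) ℝ}
    (hσ : IsAffineBijOfGramSet N σ) : σ '' isingSet N = isingSet N := by
  have hsub : isingSet N ⊆ σ '' isingSet N := by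
    intro X hX
    obtain ⟨G, hG, rfl⟩ := hσ.1.surjOn (isingSet_subset_gramSet N hX)
    refine ⟨G, ?_, rfl⟩
    by_contra hn
    exact not_onEllipse_of_mem_isingSet hX (hσ.onEllipse hG (onEllipse_of_notMem_isingSet hG hn))
  exact (Set.eq_of_subset_of_ncard_le hsub (Set.ncard_image_le (finite_isingSet N))
    ((finite_isingSet N).image σ)).symm

/-- Two affine bijections of the Gram set that agree on every Ising matrix agree on the
whole Gram set; in particular an affine bijection fixing every Ising matrix is the
identity on the Gram set, and the group of affine bijections of the Gram set is finite. -/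
theorem affineBij_determined_by_ising (N : ℕ) :
    (∀ σ τ : Matrix (Fin N) (Fin N) ℝ → Matrix (Fin N) (Fin N) ℝ,
      IsAffineBijOfGramSet N σ → IsAffineBijOfGramSet N τ →
      (∀ v : Fin N → ℝ, (∀ i, v i = 1 ∨ v i = -1) → σ (vecMulVec v v) = τ (vecMulVec v v)) →
      ∀ G ∈ GramSet N, σ G = τ G) ∧
    (∀ σ : Matrix (Fin N) (Fin N) ℝ → Matrix (Fin N) (Fin N) ℝ,
      IsAffineBijOfGramSet N σ →
      (∀ v : Fin N → ℝ, (∀ i, v i = 1 ∨ v i = -1) → σ (vecMulVec v v) = vecMulVec v v) →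
      ∀ G ∈ GramSet N, σ G = G) ∧
    Set.Finite {g : ↥(GramSet N) → Matrix (Fin N) (Fin N) ℝ |
      ∃ σ, IsAffineBijOfGramSet N σ ∧ g = (GramSet N).restrict σ} := by
  have agree : ∀ σ τ : Matrix (Fin N) (Fin N) ℝ → Matrix (Fin N) (Fin N) ℝ,
      IsAffineBijOfGramSet N σ → IsAffineBijOfGramSet N τ →
      (∀ v : Fin N → ℝ, (∀ i, v i = 1 ∨ v i = -1) → σ (vecMulVec v v) = τ (vecMulVec v v)) →
      ∀ G ∈ GramSet N, σ G = τ G := by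
    intro σ τ hσ hτ h
    refine hσ.eq_of_eqOn_ising hτ ?_
    rintro _ ⟨ε, rfl⟩
    exact h _ (signVec_eq_or ε)
  refine ⟨agree, fun σ hσ h => ?_, ?_⟩
  · exact agree σ id hσ ⟨Set.bijOn_id _, fun _ _ _ _ _ _ _ => rfl⟩ h
  · have : Finite (isingSet N) := finite_isingSet N
    refine Set.Finite.of_finite_image
      (f := fun g (X : isingSet N) => g ⟨X, isingSet_subset_gramSet N X.2⟩)
      ((Set.Finite.pi' fun _ : isingSet N => finite_isingSet N).subset ?_) ?_
    · rintro _ ⟨_, ⟨σ, hσ, rfl⟩, rfl⟩ X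
      have h := Set.mem_image_of_mem σ X.2
      rwa [hσ.image_isingSet] at h
    · rintro _ ⟨σ, hσ, rfl⟩ _ ⟨τ, hτ, rfl⟩ h
      funext G
      exact hσ.eq_of_eqOn_ising hτ (fun X hX => congrFun h ⟨X, hX⟩) G.2
end
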